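/- With the fixed-pair setup in a diregular (2,k,+3)-digraph with k ≥ 4: {u₃, u₄} ⊆ {v₃, v₄} ∪ O(v) and {v₃, v₄} ⊆ {u₃, u₄} ∪ O(u). -/

import Mathlib

/-- `p` is a directed walk from `u` to `v` in the digraph with arc relation `A`,
recorded as the list of its vertices; a walk of length `l` (i.e. with `l` arcs)
is a list of `l + 1` vertices. -/
def IsWalkFrom {V : Type*} (A : V → V → Prop) (u v : V) (p : List V) : Prop :=
  p.Chain' A ∧ p.head? = some u ∧ p.getLast? = some v

/-- A digraph is `k`-geodetic if for every ordered pair of vertices `(u, v)`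
there is at most one directed path of length at most `k` from `u` to `v`. -/
def IsKGeodetic {V : Type*} (A : V → V → Prop) (k : ℕ) : Prop :=
  ∀ (u v : V) (p q : List V), IsWalkFrom A u v p → IsWalkFrom A u v q →
    p.length ≤ k + 1 → q.length ≤ k + 1 → p = q

/-- `Nout A u = N⁺(u)`, the set of out-neighbours of `u`. -/
def Nout {V : Type*} (A : V → V → Prop) (u : V) : Set V := {v | A u v}

/-- `Nin A u = N⁻(u)`, the set of in-neighbours of `u`. -/
def Nin {V : Type*} (A : V → V → Prop) (u : V) : Set V := {v | A v u}

/-- `NIter A l u = N^l(u)`, the set of vertices reachable from `u` by a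
directed path of length exactly `l`. -/
def NIter {V : Type*} (A : V → V → Prop) (l : ℕ) (u : V) : Set V :=
  {v | ∃ p : List V, IsWalkFrom A u v p ∧ p.length = l + 1}

/-- `Ball A l u = T_l(u) = N^0(u) ∪ N^1(u) ∪ ⋯ ∪ N^l(u)`, the set of vertices
at distance at most `l` from `u`. -/
def Ball {V : Type*} (A : V → V → Prop) (l : ℕ) (u : V) : Set V :=
  {v | ∃ m ≤ l, v ∈ NIter A m u}

/-- `Outliers A k u = O(u) = {v | d(u,v) ≥ k + 1}`, the outlier set of `u`. -/
def Outliers {V : Type*} (A : V → V → Prop) (k : ℕ) (u : V) : Set V :=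
  {v | v ∉ Ball A k u}

/-- A digraph is diregular with degree `d` if every vertex has out-degree `d`
and in-degree `d`. -/
def IsDiregular {V : Type*} (A : V → V → Prop) (d : ℕ) : Prop :=
  ∀ u : V, (Nout A u).ncard = d ∧ (Nin A u).ncard = d

/-- The Moore bound `M(d,k) = 1 + d + d² + ⋯ + d^k`. -/
def moore (d k : ℕ) : ℕ := ∑ i ∈ Finset.range (k + 1), d ^ i

section Walks

variable {V : Type*} {A : V → V → Prop} {k : ℕ}

theorem mem_NIter_zero {x y : V} : y ∈ NIter A 0 x ↔ x = y := by
  constructor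
  · rintro ⟨p, ⟨-, hh, hl⟩, hlen⟩
    obtain ⟨a, rfl⟩ := List.length_eq_one_iff.mp hlen
    simp at hh hl
    exact hh.symm.trans hl
  · rintro rfl
    exact ⟨[x], ⟨List.isChain_singleton x, rfl, rfl⟩, rfl⟩

theorem IsWalkFrom.cons {x z y : V} {p : List V} (hxz : A x z) (hp : IsWalkFrom A z y p) :
    IsWalkFrom A x y (x :: p) := by
  obtain ⟨hc, hh, hl⟩ := hp
  cases p with
  | nil => simp at hh
  | cons a p =>
    simp only [List.head?_cons, Option.some.injEq] at hh
    subst hh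
    exact ⟨List.isChain_cons_cons.mpr ⟨hxz, hc⟩, rfl, by simpa using hl⟩

theorem IsWalkFrom.concat {x z y : V} {p : List V} (hp : IsWalkFrom A x z p) (hzy : A z y) :
    IsWalkFrom A x y (p ++ [y]) := by
  obtain ⟨hc, hh, hl⟩ := hp
  refine ⟨?_, by simp [hh], by simp⟩
  refine List.isChain_append.mpr ⟨hc, List.isChain_singleton y, ?_⟩
  intro a ha b hb
  simp_all

theorem mem_NIter_succ {n : ℕ} {x y : V} :
    y ∈ NIter A (n + 1) x ↔ ∃ z, A x z ∧ y ∈ NIter A n z := by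
  constructor
  · rintro ⟨p, ⟨hc, hh, hl⟩, hlen⟩
    match p, hlen with
    | a :: b :: p, hlen =>
      simp only [List.head?_cons, Option.some.injEq] at hh
      subst hh
      obtain ⟨hab, hc⟩ := List.isChain_cons_cons.mp hc
      exact ⟨b, hab, b :: p, ⟨hc, rfl, by simpa using hl⟩, by simpa using hlen⟩
  · rintro ⟨z, hz, p, hp, hlen⟩
    exact ⟨x :: p, hp.cons hz, by simp [hlen]⟩

theorem mem_NIter_one {x y : V} : y ∈ NIter A 1 x ↔ A x y := by
  simp [mem_NIter_succ, mem_NIter_zero]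

theorem NIter_trans {m n : ℕ} {x y z : V} (hxy : y ∈ NIter A m x) (hyz : z ∈ NIter A n y) :
    z ∈ NIter A (m + n) x := by
  induction m generalizing x with
  | zero =>
    obtain rfl := mem_NIter_zero.mp hxy
    simpa using hyz
  | succ m ih =>
    obtain ⟨w, hw, hy⟩ := mem_NIter_succ.mp hxy
    rw [Nat.add_right_comm]
    exact mem_NIter_succ.mpr ⟨w, hw, ih hy⟩

theorem NIter_cons {n : ℕ} {x y z : V} (hxy : A x y) (hyz : z ∈ NIter A n y) :
    z ∈ NIter A (n + 1) x :=
  mem_NIter_succ.mpr ⟨y, hxy, hyz⟩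

namespace IsKGeodetic

theorem length_unique (hgeo : IsKGeodetic A k) {m n : ℕ} {x y : V} (hm : m ≤ k) (hn : n ≤ k)
    (h₁ : y ∈ NIter A m x) (h₂ : y ∈ NIter A n x) : m = n := by
  obtain ⟨p, hp, hpl⟩ := h₁
  obtain ⟨q, hq, hql⟩ := h₂
  have := hgeo x y p q hp hq (by omega) (by omega)
  subst this
  omega

theorem first_step_unique (hgeo : IsKGeodetic A k) {m n : ℕ} {x a b y : V}
    (hm : m + 1 ≤ k) (hn : n + 1 ≤ k) (ha : A x a) (hb : A x b)
    (h₁ : y ∈ NIter A m a) (h₂ : y ∈ NIter A n b) : a = b := by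
  obtain ⟨p, hp, hpl⟩ := h₁
  obtain ⟨q, hq, hql⟩ := h₂
  have h := hgeo x y _ _ (hp.cons ha) (hq.cons hb) (by simp; omega) (by simp; omega)
  have hpq : p = q := by simpa using h
  subst hpq
  exact Option.some.inj (hp.2.1.symm.trans hq.2.1)

theorem last_step_unique (hgeo : IsKGeodetic A k) {m n : ℕ} {x a b y : V}
    (hm : m + 1 ≤ k) (hn : n + 1 ≤ k) (h₁ : a ∈ NIter A m x) (h₂ : b ∈ NIter A n x)
    (ha : A a y) (hb : A b y) : a = b := by
  obtain ⟨p, hp, hpl⟩ := h₁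
  obtain ⟨q, hq, hql⟩ := h₂
  have h := hgeo x y _ _ (hp.concat ha) (hq.concat hb) (by simp; omega) (by simp; omega)
  have hpq : p = q := by simpa using h
  subst hpq
  exact Option.some.inj (hp.2.2.symm.trans hq.2.2)

theorem not_mem_NIter_self (hgeo : IsKGeodetic A k) {n : ℕ} {x : V} (h0 : 0 < n) (hn : n ≤ k) :
    x ∉ NIter A n x := fun h =>
  h0.ne (hgeo.length_unique (Nat.zero_le k) hn (mem_NIter_zero.mpr rfl) h)

theorem ncard_NIter [Finite V] (hgeo : IsKGeodetic A k)
    (hout : ∀ x, (Nout A x).ncard = 2) {n : ℕ} (hn : n ≤ k) (x : V) :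
    (NIter A n x).ncard = 2 ^ n := by
  induction n generalizing x with
  | zero =>
    have : NIter A 0 x = {x} := by
      ext y
      simp [mem_NIter_zero, eq_comm]
    simp [this]
  | succ n ih =>
    obtain ⟨a, b, hab, hN⟩ := Set.ncard_eq_two.mp (hout x)
    have hA : ∀ z, A x z ↔ z = a ∨ z = b := fun z => Set.ext_iff.mp hN z
    have hU : NIter A (n + 1) x = NIter A n a ∪ NIter A n b := by
      ext y
      simp [mem_NIter_succ, hA, or_and_right, exists_or]
    have hd : Disjoint (NIter A n a) (NIter A n b) :=
      Set.disjoint_left.mpr fun y ha hb =>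
        hab (hgeo.first_step_unique hn hn ((hA a).mpr (.inl rfl)) ((hA b).mpr (.inr rfl)) ha hb)
    rw [hU, Set.ncard_union_eq hd, ih (by omega), ih (by omega)]
    ring

theorem ncard_Ball [Finite V] (hgeo : IsKGeodetic A k)
    (hout : ∀ x, (Nout A x).ncard = 2) {l : ℕ} (hl : l ≤ k) (x : V) :
    (Ball A l x).ncard = moore 2 l := by
  induction l with
  | zero =>
    have : Ball A 0 x = NIter A 0 x := by
      ext y
      simp [Ball]
    rw [this, hgeo.ncard_NIter hout hl]
    simp [moore]
  | succ l ih =>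
    have hU : Ball A (l + 1) x = Ball A l x ∪ NIter A (l + 1) x := by
      ext y
      simp only [Ball, Set.mem_ofPred_eq, Set.mem_union]
      constructor
      · rintro ⟨m, hm, hy⟩
        rcases hm.eq_or_lt with rfl | hm
        · exact .inr hy
        · exact .inl ⟨m, by omega, hy⟩
      · rintro (⟨m, hm, hy⟩ | hy)
        · exact ⟨m, by omega, hy⟩
        · exact ⟨l + 1, le_rfl, hy⟩
    have hd : Disjoint (Ball A l x) (NIter A (l + 1) x) := by
      refine Set.disjoint_left.mpr ?_
      rintro y ⟨m, hm, hy⟩ hy'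
      have := hgeo.length_unique (by omega) hl hy hy'
      omega
    rw [hU, Set.ncard_union_eq hd, ih (by omega), hgeo.ncard_NIter hout hl]
    simp [moore, Finset.sum_range_succ _ (l + 1)]

theorem ncard_Outliers [Fintype V] (hgeo : IsKGeodetic A k)
    (hout : ∀ x, (Nout A x).ncard = 2) {e : ℕ} (hcard : Fintype.card V = moore 2 k + e) (x : V) :
    (Outliers A k x).ncard = e := by
  have h := Set.ncard_add_ncard_compl (Ball A k x)
  rw [hgeo.ncard_Ball hout le_rfl, Nat.card_eq_fintype_card, hcard] at h
  have hO : Outliers A k x = (Ball A k x)ᶜ := rfl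
  rw [hO]
  omega

/-- Every outlier of an out-neighbour of `v` is an out-neighbour of an outlier of `v`. -/
theorem exists_adj_outlier (hgeo : IsKGeodetic A k) {v v₁ v₂ x : V} (hv : Nout A v = {v₁, v₂})
    (hin : (Nin A x).ncard = 2) (hx : x ∈ Outliers A k v₁) :
    ∃ y ∈ Outliers A k v, A y x := by
  obtain ⟨a, b, hab, hN⟩ := Set.ncard_eq_two.mp hin
  have ha : A a x := (Set.ext_iff.mp hN a).mpr (.inl rfl)
  have hb : A b x := (Set.ext_iff.mp hN b).mpr (.inr rfl)
  have hA : ∀ z, A v z → z = v₁ ∨ z = v₂ := fun z hz => (Set.ext_iff.mp hv z).mp hz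
  by_contra! hcon
  have key : ∀ c, A c x →
      c = v ∧ x = v₂ ∨ ∃ j, j + 1 ≤ k ∧ c ∈ NIter A j v₂ := by
    intro c hc
    obtain ⟨m, hm, hcm⟩ : c ∈ Ball A k v := not_not.mp fun h => hcon c h hc
    cases m with
    | zero =>
      obtain rfl := mem_NIter_zero.mp hcm
      rcases hA x hc with rfl | h
      · exact absurd ⟨0, Nat.zero_le k, mem_NIter_zero.mpr rfl⟩ hx
      · exact .inl ⟨rfl, h⟩
    | succ j =>
      obtain ⟨z, hz, hcz⟩ := mem_NIter_succ.mp hcm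
      rcases hA z hz with rfl | rfl
      · exact absurd ⟨j + 1, hm, NIter_trans hcz (mem_NIter_one.mpr hc)⟩ hx
      · exact .inr ⟨j, hm, hcz⟩
  have cyc : ∀ c, A c x → x = v₂ → ¬ ∃ j, j + 1 ≤ k ∧ c ∈ NIter A j v₂ := by
    rintro c hc rfl ⟨j, hj, hcj⟩
    exact hgeo.not_mem_NIter_self (Nat.succ_pos j) hj (NIter_trans hcj (mem_NIter_one.mpr hc))
  rcases key a ha with ⟨rfl, hx₂⟩ | ⟨i, hi, hai⟩
  · rcases key b hb with ⟨rfl, -⟩ | h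
    · exact hab rfl
    · exact cyc b hb hx₂ h
  · rcases key b hb with ⟨-, hx₂⟩ | ⟨j, hj, hbj⟩
    · exact cyc a ha hx₂ ⟨i, hi, hai⟩
    · exact hab (hgeo.last_step_unique hi hj hai hbj ha hb)

end IsKGeodetic

end Walks

section CommonOutNeighbour

variable {V : Type*} {A : V → V → Prop} {k : ℕ} {u v u₁ u₂ v₁ : V}

theorem eq_or_mem_or_outlier_of_mem_branch (hgeo : IsKGeodetic A k)
    (hu : Nout A u = {u₁, u₂}) (hv : Nout A v = {v₁, u₂}) (hne : u₁ ≠ u₂)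
    {t : ℕ} {x : V} (ht : t + 1 ≤ k) (hx : x ∈ NIter A t u₁) :
    x = v ∨ (∃ l, l + 1 ≤ k ∧ x ∈ NIter A l v₁) ∨ x ∈ Outliers A k v := by
  by_cases hO : x ∈ Outliers A k v
  · exact .inr (.inr hO)
  obtain ⟨m, hm, hxm⟩ : x ∈ Ball A k v := not_not.mp hO
  cases m with
  | zero => exact .inl (mem_NIter_zero.mp hxm).symm
  | succ j =>
    obtain ⟨z, hz, hxz⟩ := mem_NIter_succ.mp hxm
    rcases (Set.ext_iff.mp hv z).mp hz with rfl | rfl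
    · exact .inr (.inl ⟨j, hm, hxz⟩)
    · exact absurd (hgeo.first_step_unique ht hm ((Set.ext_iff.mp hu _).mpr (.inl rfl))
        ((Set.ext_iff.mp hu _).mpr (.inr rfl)) hx hxz) hne

theorem NIter_subset_insert_outliers (hgeo : IsKGeodetic A k)
    (hu : Nout A u = {u₁, u₂}) (hv : Nout A v = {v₁, u₂}) (hne : u₁ ≠ u₂)
    {t l s : ℕ} {x : V} (hs : l + s = k) (htl : t < l)
    (hxu : x ∈ NIter A t u₁) (hxv : x ∈ NIter A l v₁) :
    NIter A s x ⊆ insert v (Outliers A k v) := by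
  intro y hy
  rcases eq_or_mem_or_outlier_of_mem_branch hgeo hu hv hne (by omega) (NIter_trans hxu hy)
    with h | ⟨m, hm, h⟩ | h
  · exact .inl h
  · have := hgeo.length_unique (by omega) (by omega) h (NIter_trans hxv hy)
    omega
  · exact .inr h

theorem le_two_of_mem_branches [Finite V] (hgeo : IsKGeodetic A k)
    (hout : ∀ x, (Nout A x).ncard = 2) (hO : (Outliers A k v).ncard = 3)
    (hu : Nout A u = {u₁, u₂}) (hv : Nout A v = {v₁, u₂}) (hne : u₁ ≠ u₂)
    {t l s : ℕ} {x : V} (hs : l + s = k) (htl : t < l)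
    (hxu : x ∈ NIter A t u₁) (hxv : x ∈ NIter A l v₁) : s ≤ 2 := by
  have h := Set.ncard_le_ncard (NIter_subset_insert_outliers hgeo hu hv hne hs htl hxu hxv)
  rw [hgeo.ncard_NIter hout (by omega)] at h
  have h4 : 2 ^ s ≤ 2 ^ 2 := h.trans ((Set.ncard_insert_le _ _).trans (by omega))
  exact (Nat.pow_le_pow_iff_right (by norm_num)).mp h4

theorem le_of_mem_NIter_branch (hgeo : IsKGeodetic A k) (hk : 1 ≤ k)
    (hu : Nout A u = {u₁, u₂}) (hv : Nout A v = {v₁, u₂})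
    {t : ℕ} (h : v ∈ NIter A t u₁) : k ≤ t + 1 := by
  by_contra! hlt
  have h₁ : A u u₁ := (Set.ext_iff.mp hu _).mpr (.inl rfl)
  have h₂ : A u u₂ := (Set.ext_iff.mp hu _).mpr (.inr rfl)
  have h₃ : A v u₂ := (Set.ext_iff.mp hv _).mpr (.inr rfl)
  have := hgeo.length_unique (by omega) hk
    (NIter_trans (NIter_cons h₁ h) (mem_NIter_one.mpr h₃)) (mem_NIter_one.mpr h₂)
  omega

theorem adj_or_outlier_of_adj_branch [Fintype V]
    (hreg : IsDiregular A 2) (hgeo : IsKGeodetic A k)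
    (hcard : Fintype.card V = moore 2 k + 3)
    (hu : Nout A u = {u₁, u₂}) (hv : Nout A v = {v₁, u₂}) (huv : u₁ ≠ v₁) (hk : 4 ≤ k)
    {w : V} (hw : A u₁ w) : A v₁ w ∨ w ∈ Outliers A k v := by
  have hout : ∀ x, (Nout A x).ncard = 2 := fun x => (hreg x).1
  have hO := hgeo.ncard_Outliers hout hcard
  have hne : u₁ ≠ u₂ := by
    rintro rfl
    have := hout u
    simp [hu] at this
  have hne' : v₁ ≠ u₂ := by
    rintro rfl
    have := hout v
    simp [hv] at this
  by_contra! hcon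
  obtain ⟨hnA, hnO⟩ := hcon
  have hself : u₁ ∈ NIter A 0 u₁ := mem_NIter_zero.mpr rfl
  have hw1 : w ∈ NIter A 1 u₁ := mem_NIter_one.mpr hw
  have hu₁O : u₁ ∈ Outliers A k v := by
    rcases eq_or_mem_or_outlier_of_mem_branch hgeo hu hv hne (by omega) hself
      with h | ⟨l, hl, h⟩ | h
    · have := le_of_mem_NIter_branch hgeo (by omega) hu hv (mem_NIter_zero.mpr h)
      omega
    · have hl0 : 0 < l := by
        rcases Nat.eq_zero_or_pos l with rfl | h0
        · exact absurd (mem_NIter_zero.mp h).symm huv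
        · exact h0
      obtain ⟨s, hs⟩ := Nat.exists_eq_add_of_le (show l ≤ k by omega)
      have hs2 := le_two_of_mem_branches hgeo hout (hO v) hu hv hne hs.symm hl0 hself h
      have hsub : NIter A s u₁ ⊆ Outliers A k v := by
        intro y hy
        rcases NIter_subset_insert_outliers hgeo hu hv hne hs.symm hl0 hself h hy with rfl | h'
        · have := le_of_mem_NIter_branch hgeo (by omega) hu hv hy
          omega
        · exact h'
      have hc := Set.ncard_le_ncard hsub
      rw [hgeo.ncard_NIter hout (by omega), hO] at hc
      obtain rfl : s = 1 := by
        interval_cases s <;> omega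
      exact absurd (hsub hw1) hnO
    · exact h
  obtain ⟨l, hl, hwl⟩ : ∃ l, l + 1 ≤ k ∧ w ∈ NIter A l v₁ := by
    rcases eq_or_mem_or_outlier_of_mem_branch hgeo hu hv hne (by omega) hw1 with h | h | h
    · have := le_of_mem_NIter_branch hgeo (by omega) hu hv (h ▸ hw1)
      omega
    · exact h
    · exact absurd h hnO
  have hl2 : 1 < l := by
    by_contra! hle
    interval_cases l
    · have := le_two_of_mem_branches hgeo hout (hO u) hv hu hne'
        (show 1 + (k - 1) = k by omega) Nat.zero_lt_one hwl hw1
      omega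
    · exact hnA (mem_NIter_one.mp hwl)
  obtain ⟨s, hs⟩ := Nat.exists_eq_add_of_le (show l ≤ k by omega)
  have hu₁N : ∀ j, j + 1 ≤ k → u₁ ∉ NIter A j w := fun j hj h =>
    hgeo.not_mem_NIter_self (Nat.succ_pos j) hj (NIter_cons hw h)
  have hs2 := le_two_of_mem_branches hgeo hout (hO v) hu hv hne hs.symm hl2 hw1 hwl
  have hsub := NIter_subset_insert_outliers hgeo hu hv hne hs.symm hl2 hw1 hwl
  have hcw : (insert u₁ (NIter A s w)).ncard = 2 ^ s + 1 := by
    rw [Set.ncard_insert_of_notMem (hu₁N s (by omega)), hgeo.ncard_NIter hout (by omega)]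
  obtain rfl : s = 1 := by
    have h := Set.ncard_le_ncard (Set.insert_subset (Set.mem_insert_of_mem v hu₁O) hsub)
    have h' := Set.ncard_insert_le v (Outliers A k v)
    rw [hcw] at h
    rw [hO] at h'
    interval_cases s <;> omega
  have hsubO : insert u₁ (NIter A 1 w) ⊆ Outliers A k v := by
    refine Set.insert_subset hu₁O fun y hy => ?_
    rcases hsub hy with rfl | h
    · have := le_of_mem_NIter_branch hgeo (by omega) hu hv (NIter_trans hw1 hy)
      omega
    · exact h
  have hOeq : insert u₁ (NIter A 1 w) = Outliers A k v :=
    Set.eq_of_subset_of_ncard_le hsubO (by rw [hcw, hO]; norm_num)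
  have hsubO₁ : Outliers A k v₁ ⊆ insert v (Nout A u₁ \ {w}) := by
    intro x hx
    obtain ⟨y, hy, hyx⟩ := hgeo.exists_adj_outlier hv (hreg x).2 hx
    rw [← hOeq] at hy
    rcases hy with rfl | hy
    · refine .inr ⟨hyx, ?_⟩
      rintro rfl
      exact hx ⟨l, by omega, hwl⟩
    · have hx3 : x ∈ NIter A 3 u₁ :=
        NIter_trans (NIter_trans hw1 hy) (mem_NIter_one.mpr hyx)
      rcases eq_or_mem_or_outlier_of_mem_branch hgeo hu hv hne (by omega) hx3
        with h | ⟨m, hm, h⟩ | h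
      · exact .inl h
      · exact absurd ⟨m, by omega, h⟩ hx
      · rw [← hOeq] at h
        rcases h with rfl | h
        · exact absurd hx3 (hgeo.not_mem_NIter_self (by omega) (by omega))
        · have := hgeo.length_unique (by omega) (by omega) hx3 (NIter_trans hw1 h)
          omega
  have h := Set.ncard_le_ncard hsubO₁
  have h' := Set.ncard_insert_le v (Nout A u₁ \ {w})
  rw [hO] at h
  rw [Set.ncard_sdiff_singleton_of_mem (show w ∈ Nout A u₁ from hw), hout] at h'
  omega

end CommonOutNeighbour

/-- Fixed-pair setup, `k ≥ 4`: `{u₃,u₄} ⊆ {v₃,v₄} ∪ O(v)` and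
`{v₃,v₄} ⊆ {u₃,u₄} ∪ O(u)`. -/
theorem position_of_u3_u4 {V : Type*} [Fintype V] (A : V → V → Prop) (k : ℕ)
    (u v u₁ u₂ v₁ : V)
    (hirr : Irreflexive A) (hreg : IsDiregular A 2) (hgeo : IsKGeodetic A k)
    (hcard : Fintype.card V = moore 2 k + 3)
    (hu : Nout A u = {u₁, u₂}) (hv : Nout A v = {v₁, u₂}) (huv : u₁ ≠ v₁)
    (u₃ u₄ v₃ v₄ : V)
    (hu₁ : Nout A u₁ = {u₃, u₄}) (hv₁ : Nout A v₁ = {v₃, v₄})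
    (hk : 4 ≤ k) :
    ({u₃, u₄} : Set V) ⊆ ({v₃, v₄} : Set V) ∪ Outliers A k v ∧
      ({v₃, v₄} : Set V) ⊆ ({u₃, u₄} : Set V) ∪ Outliers A k u := by
  have h₁ : ∀ w, w ∈ ({u₃, u₄} : Set V) ↔ A u₁ w := fun w => (Set.ext_iff.mp hu₁ w).symm
  have h₂ : ∀ w, w ∈ ({v₃, v₄} : Set V) ↔ A v₁ w := fun w => (Set.ext_iff.mp hv₁ w).symm
  refine ⟨fun w hw => ?_, fun w hw => ?_⟩
  · exact (adj_or_outlier_of_adj_branch hreg hgeo hcard hu hv huv hk ((h₁ w).mp hw)).imp_left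
      (h₂ w).mpr
  · exact (adj_or_outlier_of_adj_branch hreg hgeo hcard hv hu huv.symm hk ((h₂ w).mp hw)).imp_left
      (h₁ w).mpr
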